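/- arXiv:1710.08937 — 3 statements merged into one kernel-verified Lean document; each statement's English description precedes it below -/
import Mathlib

section
/- Let x = (x_1, …, x_n) be a time series with x_i = x_{i+1} for some i ∈ [n−1], and let x' = (x_1, …, x_i, x_{i+2}, …, x_n) be the time series obtained from x by deleting the element x_{i+1}. Then for every time series y, dtw(x', y) ≤ dtw(x, y). -/
/-- A warping path of order `m × n` (pairs are 1-indexed): it starts at `(1,1)`,
ends at `(m,n)`, stays within `[m] × [n]`, and each step is one of
`(+1,0)`, `(0,+1)`, `(+1,+1)`. -/
def IsWarpingPath (m n : ℕ) (p : List (ℕ × ℕ)) : Prop :=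
  p.head? = some (1, 1) ∧
  p.getLast? = some (m, n) ∧
  (∀ q ∈ p, 1 ≤ q.1 ∧ q.1 ≤ m ∧ 1 ≤ q.2 ∧ q.2 ≤ n) ∧
  ∀ ℓ : ℕ, ℓ + 1 < p.length →
    ((p.getD (ℓ + 1) (0, 0)).1 = (p.getD ℓ (0, 0)).1 + 1 ∧
       (p.getD (ℓ + 1) (0, 0)).2 = (p.getD ℓ (0, 0)).2) ∨
    ((p.getD (ℓ + 1) (0, 0)).1 = (p.getD ℓ (0, 0)).1 ∧
       (p.getD (ℓ + 1) (0, 0)).2 = (p.getD ℓ (0, 0)).2 + 1) ∨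
    ((p.getD (ℓ + 1) (0, 0)).1 = (p.getD ℓ (0, 0)).1 + 1 ∧
       (p.getD (ℓ + 1) (0, 0)).2 = (p.getD ℓ (0, 0)).2 + 1)

/-- The cost `C_p(x,y)` of aligning time series `x` and `y` (1-indexed, given as
lists of rationals) along the warping path `p`. -/
def alignCost (x y : List ℚ) (p : List (ℕ × ℕ)) : ℚ :=
  (p.map fun q => (x.getD (q.1 - 1) 0 - y.getD (q.2 - 1) 0) ^ 2).sum

/-- The squared dtw-distance: the minimum alignment cost over all warping paths
of order `x.length × y.length`. -/
noncomputable def dtwSq (x y : List ℚ) : ℝ :=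
  sInf {c : ℝ | ∃ p : List (ℕ × ℕ),
    IsWarpingPath x.length y.length p ∧ c = (alignCost x y p : ℝ)}

/-- The dtw-distance. -/
noncomputable def dtw (x y : List ℚ) : ℝ := Real.sqrt (dtwSq x y)

/-- The admissible steps of a warping path. -/
def WarpingStep (a b : ℕ × ℕ) : Prop :=
  (b.1 = a.1 + 1 ∧ b.2 = a.2) ∨ (b.1 = a.1 ∧ b.2 = a.2 + 1) ∨ (b.1 = a.1 + 1 ∧ b.2 = a.2 + 1)

theorem isWarpingPath_iff_isChain {m n : ℕ} {p : List (ℕ × ℕ)} :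
    IsWarpingPath m n p ↔ p.head? = some (1, 1) ∧ p.getLast? = some (m, n) ∧
      (∀ q ∈ p, 1 ≤ q.1 ∧ q.1 ≤ m ∧ 1 ≤ q.2 ∧ q.2 ≤ n) ∧ p.IsChain WarpingStep := by
  unfold IsWarpingPath
  refine and_congr_right fun _ => and_congr_right fun _ => and_congr_right fun _ => ?_
  rw [List.isChain_iff_getElem]
  refine forall_congr' fun k => forall_congr' fun hk => ?_
  rw [List.getD_eq_getElem _ _ hk, List.getD_eq_getElem _ _ (Nat.lt_of_succ_lt hk)]
  rfl

/-- A list whose consecutive entries are related or equal can be thinned to a chain with the same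
endpoints. -/
theorem List.IsChain.exists_sublist_of_or_eq {α : Type*} {R : α → α → Prop} {l : List α}
    (h : l.IsChain fun a b => R a b ∨ a = b) :
    ∃ q : List α, q.Sublist l ∧ q.IsChain R ∧ q.head? = l.head? ∧ q.getLast? = l.getLast? := by
  induction l with
  | nil => exact ⟨[], by simp⟩
  | cons a t ih =>
    cases t with
    | nil => exact ⟨[a], by simp⟩
    | cons b t =>
      rw [List.isChain_cons_cons] at h
      obtain ⟨q, hsub, hchain, hhead, hlast⟩ := ih h.2
      rcases h.1 with hab | rfl
      · refine ⟨a :: q, hsub.cons_cons a, ?_, rfl, ?_⟩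
        · rw [List.isChain_cons]
          refine ⟨fun y hy => ?_, hchain⟩
          rw [hhead] at hy
          simp only [List.head?_cons, Option.mem_def, Option.some.injEq] at hy
          exact hy ▸ hab
        · rw [List.getLast?_cons, List.getLast?_cons, hlast]
      · exact ⟨q, hsub.cons a, hchain, hhead, by rw [hlast, List.getLast?_cons_cons]⟩

theorem IsWarpingPath.concat {m n m' n' : ℕ} {p : List (ℕ × ℕ)} (hp : IsWarpingPath m n p)
    (h : WarpingStep (m, n) (m', n')) : IsWarpingPath m' n' (p ++ [(m', n')]) := by
  rw [isWarpingPath_iff_isChain] at hp ⊢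
  obtain ⟨hhead, hlast, hmem, hchain⟩ := hp
  have hmn := hmem _ (List.mem_of_getLast? hlast)
  have hle : m ≤ m' ∧ n ≤ n' := by
    simp only [WarpingStep] at h
    omega
  refine ⟨by simp [hhead], by simp, fun q hq => ?_, ?_⟩
  · rcases List.mem_append.1 hq with hq | hq
    · have := hmem q hq
      omega
    · rw [List.mem_singleton.1 hq]
      dsimp only at hmn ⊢
      omega
  · rw [List.isChain_append]
    refine ⟨hchain, by simp, fun a ha b hb => ?_⟩
    rw [hlast] at ha
    simp only [List.head?_cons, Option.mem_def, Option.some.injEq] at ha hb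
    exact ha ▸ hb ▸ h

theorem exists_isWarpingPath {m n : ℕ} (hm : 1 ≤ m) (hn : 1 ≤ n) :
    ∃ p, IsWarpingPath m n p := by
  induction m, hm using Nat.le_induction with
  | base =>
    induction n, hn using Nat.le_induction with
    | base => exact ⟨[(1, 1)], by simp [IsWarpingPath]⟩
    | succ n _ ih =>
      obtain ⟨p, hp⟩ := ih
      exact ⟨_, hp.concat (Or.inr (Or.inl ⟨rfl, rfl⟩))⟩
  | succ m _ ih =>
    obtain ⟨p, hp⟩ := ih
    exact ⟨_, hp.concat (Or.inl ⟨rfl, rfl⟩)⟩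

theorem alignCost_nonneg (x y : List ℚ) (p : List (ℕ × ℕ)) : 0 ≤ alignCost x y p := by
  refine List.sum_nonneg fun c hc => ?_
  obtain ⟨q, -, rfl⟩ := List.mem_map.1 hc
  positivity

theorem alignCost_le_of_sublist (x y : List ℚ) {p q : List (ℕ × ℕ)} (h : p.Sublist q) :
    alignCost x y p ≤ alignCost x y q := by
  refine (h.map _).sum_le_sum fun c hc => ?_
  obtain ⟨q, -, rfl⟩ := List.mem_map.1 hc
  positivity

/-- The reindexing of first coordinates which merges the indices `i` and `i + 1`. -/
def mergeIndex (i : ℕ) (q : ℕ × ℕ) : ℕ × ℕ := (if q.1 ≤ i then q.1 else q.1 - 1, q.2)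

theorem getD_eraseIdx_mergeIndex {x : List ℚ} {i : ℕ} (hi : 1 ≤ i)
    (hdup : x.getD (i - 1) 0 = x.getD i 0) (q : ℕ × ℕ) :
    (x.eraseIdx i).getD ((mergeIndex i q).1 - 1) 0 = x.getD (q.1 - 1) 0 := by
  rw [List.getD_eq_getElem?_getD, List.getElem?_eraseIdx]
  unfold mergeIndex
  by_cases h : q.1 ≤ i
  · rw [if_pos h, if_pos (by dsimp only; omega), List.getD_eq_getElem?_getD]
  · rw [if_neg h]
    by_cases h' : q.1 = i + 1
    · rw [if_pos (by dsimp only; omega), h', Nat.add_sub_cancel, ← hdup,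
        List.getD_eq_getElem?_getD]
    · rw [if_neg (by dsimp only; omega), List.getD_eq_getElem?_getD]
      congr 2
      dsimp only
      omega

theorem alignCost_map_mergeIndex {x : List ℚ} {i : ℕ} (hi : 1 ≤ i)
    (hdup : x.getD (i - 1) 0 = x.getD i 0) (y : List ℚ) (p : List (ℕ × ℕ)) :
    alignCost (x.eraseIdx i) y (p.map (mergeIndex i)) = alignCost x y p := by
  unfold alignCost
  rw [List.map_map]
  congr 2
  funext q
  rw [Function.comp_apply, getD_eraseIdx_mergeIndex hi hdup]
  rfl

theorem WarpingStep.mergeIndex {a b : ℕ × ℕ} (h : WarpingStep a b) (i : ℕ) :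
    WarpingStep (mergeIndex i a) (mergeIndex i b) ∨ mergeIndex i a = mergeIndex i b := by
  simp only [WarpingStep, _root_.mergeIndex, Prod.mk.injEq] at h ⊢
  split_ifs <;> omega

theorem IsWarpingPath.exists_sublist_map_mergeIndex {m n i : ℕ} {p : List (ℕ × ℕ)}
    (hp : IsWarpingPath m n p) (hi : 1 ≤ i) (him : i + 1 ≤ m) :
    ∃ q, q.Sublist (p.map (mergeIndex i)) ∧ IsWarpingPath (m - 1) n q := by
  obtain ⟨hhead, hlast, hmem, hchain⟩ := isWarpingPath_iff_isChain.1 hp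
  have hchain' : (p.map (mergeIndex i)).IsChain fun a b => WarpingStep a b ∨ a = b := by
    rw [List.isChain_map]
    exact hchain.imp fun a b h => h.mergeIndex i
  obtain ⟨q, hsub, hq, hqhead, hqlast⟩ := hchain'.exists_sublist_of_or_eq
  refine ⟨q, hsub, isWarpingPath_iff_isChain.2 ⟨?_, ?_, fun r hr => ?_, hq⟩⟩
  · rw [hqhead, List.head?_map, hhead]
    simp [mergeIndex, hi]
  · rw [hqlast, List.getLast?_map, hlast]
    simp [mergeIndex, Nat.not_le.2 him]
  · obtain ⟨a, ha, rfl⟩ := List.mem_map.1 (hsub.subset hr)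
    have := hmem a ha
    unfold mergeIndex
    dsimp only
    split_ifs <;> omega

/-- If `x` has two equal consecutive elements `x_i = x_{i+1}` (1-indexed,
`i ∈ [n-1]`), then deleting `x_{i+1}` does not increase the dtw-distance to any
time series `y`. -/
theorem dtw_erase_dup_le (x : List ℚ) (i : ℕ) (hi1 : 1 ≤ i)
    (hin : i + 1 ≤ x.length) (hdup : x.getD (i - 1) 0 = x.getD i 0)
    (y : List ℚ) :
    dtw (x.eraseIdx i) y ≤ dtw x y := by
  refine Real.sqrt_le_sqrt ?_
  unfold dtwSq
  have hlen : (x.eraseIdx i).length = x.length - 1 := List.length_eraseIdx_of_lt hin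
  rcases Nat.eq_zero_or_pos y.length with hy | hy
  · have hempty : ∀ z : List ℚ, {c : ℝ | ∃ p : List (ℕ × ℕ),
        IsWarpingPath z.length y.length p ∧ c = (alignCost z y p : ℝ)} = ∅ := by
      refine fun z => Set.eq_empty_of_forall_notMem ?_
      rintro c ⟨p, ⟨-, hlast, hmem, -⟩, -⟩
      have := hmem _ (List.mem_of_getLast? hlast)
      dsimp only at this
      omega
    rw [hempty, hempty]
  · obtain ⟨p₀, hp₀⟩ := exists_isWarpingPath (Nat.one_le_of_lt hin) hy
    refine le_csInf ⟨_, p₀, hp₀, rfl⟩ ?_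
    rintro c ⟨p, hp, rfl⟩
    obtain ⟨q, hsub, hq⟩ := hp.exists_sublist_map_mergeIndex hi1 hin
    have hcost : alignCost (x.eraseIdx i) y q ≤ alignCost x y p :=
      (alignCost_le_of_sublist _ _ hsub).trans_eq (alignCost_map_mergeIndex hi1 hdup y p)
    refine csInf_le_of_le ⟨0, ?_⟩ ⟨q, by rwa [hlen], rfl⟩ (Rat.cast_le.2 hcost)
    rintro c ⟨r, -, rfl⟩
    exact Rat.cast_nonneg.2 (alignCost_nonneg _ _ r)
end

section
/- Let x = (x_1, …, x_n) be a condensed binary time series and let y = (y_1, …, y_m) be any binary time series with n ≥ m. Then for the condensation ỹ of y it holds that dtw(x, y)² = dtw(x, ỹ)². -/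
/-- A time series is condensed if no two consecutive elements are equal. -/
def IsCondensed (x : List ℚ) : Prop := x.Chain' (· ≠ ·)

/-- The condensation of a time series: repeatedly remove one of two equal
consecutive elements until the series is condensed. -/
def condense (x : List ℚ) : List ℚ := x.destutter (· ≠ ·)

/-- A binary time series: every element is `0` or `1`. -/
def IsBinary (x : List ℚ) : Prop := ∀ a ∈ x, a = 0 ∨ a = 1

/-- `AlignsWith x y c`: some warping path aligns the nonempty series `x` and `y` at cost `c`,
described recursively by the first step of the path. -/
inductive AlignsWith : List ℚ → List ℚ → ℚ → Prop
  | single (a b : ℚ) : AlignsWith [a] [b] ((a - b) ^ 2)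
  | left {x y : List ℚ} {b c : ℚ} (a : ℚ) (h : AlignsWith x (b :: y) c) :
      AlignsWith (a :: x) (b :: y) ((a - b) ^ 2 + c)
  | right {x y : List ℚ} {a c : ℚ} (b : ℚ) (h : AlignsWith (a :: x) y c) :
      AlignsWith (a :: x) (b :: y) ((a - b) ^ 2 + c)
  | diag {x y : List ℚ} {c : ℚ} (a b : ℚ) (h : AlignsWith x y c) :
      AlignsWith (a :: x) (b :: y) ((a - b) ^ 2 + c)

/-- The step relation of warping paths. -/
def WarpStep (q r : ℕ × ℕ) : Prop :=
  (r.1 = q.1 + 1 ∧ r.2 = q.2) ∨ (r.1 = q.1 ∧ r.2 = q.2 + 1) ∨ (r.1 = q.1 + 1 ∧ r.2 = q.2 + 1)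

theorem isWarpingPath_iff {m n : ℕ} {p : List (ℕ × ℕ)} :
    IsWarpingPath m n p ↔ p.head? = some (1, 1) ∧ p.getLast? = some (m, n) ∧
      (∀ q ∈ p, 1 ≤ q.1 ∧ q.1 ≤ m ∧ 1 ≤ q.2 ∧ q.2 ≤ n) ∧ p.IsChain WarpStep := by
  unfold IsWarpingPath
  refine and_congr_right fun _ => and_congr_right fun _ => and_congr_right fun _ => ?_
  rw [List.isChain_iff_getElem]
  refine forall_congr' fun i => forall_congr' fun hi => ?_
  rw [List.getD_eq_getElem _ _ hi, List.getD_eq_getElem _ _ (Nat.lt_of_succ_lt hi)]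
  rfl

theorem alignCost_cons (x y : List ℚ) (q : ℕ × ℕ) (p : List (ℕ × ℕ)) :
    alignCost x y (q :: p) = (x.getD (q.1 - 1) 0 - y.getD (q.2 - 1) 0) ^ 2 + alignCost x y p := by
  simp [alignCost]

theorem alignsWith_drop_of_path (x y : List ℚ) (p : List (ℕ × ℕ)) (i j : ℕ)
    (hhead : p.head? = some (i + 1, j + 1)) (hlast : p.getLast? = some (x.length, y.length))
    (hbd : ∀ q ∈ p, q.1 ≤ x.length ∧ q.2 ≤ y.length) (hchain : p.IsChain WarpStep) :
    AlignsWith (x.drop i) (y.drop j) (alignCost x y p) := by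
  induction p generalizing i j with
  | nil => simp at hhead
  | cons q p ih =>
    obtain rfl : q = (i + 1, j + 1) := by simpa using hhead
    obtain ⟨hi, hj⟩ := hbd _ List.mem_cons_self
    simp only at hi hj
    rw [alignCost_cons, List.drop_eq_getElem_cons hi, List.drop_eq_getElem_cons hj]
    simp only [Nat.add_sub_cancel, List.getD_eq_getElem _ _ hi, List.getD_eq_getElem _ _ hj]
    cases p with
    | nil =>
      simp only [List.getLast?_singleton, Option.some.injEq, Prod.mk.injEq] at hlast
      rw [List.drop_of_length_le hlast.1.ge, List.drop_of_length_le hlast.2.ge]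
      simpa [alignCost] using AlignsWith.single x[i] y[j]
    | cons r p =>
      rw [List.isChain_cons_cons] at hchain
      have rec_at (i' j' : ℕ) (hr : r = (i' + 1, j' + 1)) :=
        ih i' j' (by simp [hr]) (by simpa using hlast)
          (fun q hq => hbd q (List.mem_cons_of_mem _ hq)) hchain.2
      rcases hchain.1 with h | h | h
      · have := rec_at (i + 1) j (Prod.ext h.1 h.2)
        rw [List.drop_eq_getElem_cons hj] at this
        exact this.left _
      · have := rec_at i (j + 1) (Prod.ext h.1 h.2)
        rw [List.drop_eq_getElem_cons hi] at this
        exact this.right _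
      · exact (rec_at (i + 1) (j + 1) (Prod.ext h.1 h.2)).diag _ _

theorem List.getD_and_drop_of_drop_eq_cons {x u : List ℚ} {i : ℕ} {a : ℚ}
    (h : x.drop i = a :: u) :
    i < x.length ∧ x.getD i 0 = a ∧ x.drop (i + 1) = u := by
  have hi : i < x.length := by
    by_contra hi
    simp [List.drop_of_length_le (not_lt.mp hi)] at h
  rw [List.drop_eq_getElem_cons hi] at h
  obtain ⟨h₁, h₂⟩ := List.cons.inj h
  exact ⟨hi, by rw [List.getD_eq_getElem _ _ hi, h₁], h₂⟩

theorem exists_path_of_alignsWith_drop (x y : List ℚ) {u v : List ℚ} {c : ℚ}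
    (h : AlignsWith u v c) (i j : ℕ) (hu : x.drop i = u) (hv : y.drop j = v) :
    ∃ p : List (ℕ × ℕ), p.head? = some (i + 1, j + 1) ∧
      p.getLast? = some (x.length, y.length) ∧
      (∀ q ∈ p, 1 ≤ q.1 ∧ q.1 ≤ x.length ∧ 1 ≤ q.2 ∧ q.2 ≤ y.length) ∧
      p.IsChain WarpStep ∧ alignCost x y p = c := by
  have extend {a b c : ℚ} {u v : List ℚ} {i j i' j' : ℕ}
      (hu : x.drop i = a :: u) (hv : y.drop j = b :: v)
      (hs : WarpStep (i + 1, j + 1) (i' + 1, j' + 1))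
      (h : ∃ p : List (ℕ × ℕ), p.head? = some (i' + 1, j' + 1) ∧
        p.getLast? = some (x.length, y.length) ∧
        (∀ q ∈ p, 1 ≤ q.1 ∧ q.1 ≤ x.length ∧ 1 ≤ q.2 ∧ q.2 ≤ y.length) ∧
        p.IsChain WarpStep ∧ alignCost x y p = c) :
      ∃ p : List (ℕ × ℕ), p.head? = some (i + 1, j + 1) ∧
        p.getLast? = some (x.length, y.length) ∧
        (∀ q ∈ p, 1 ≤ q.1 ∧ q.1 ≤ x.length ∧ 1 ≤ q.2 ∧ q.2 ≤ y.length) ∧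
        p.IsChain WarpStep ∧ alignCost x y p = (a - b) ^ 2 + c := by
    obtain ⟨hi, hx, -⟩ := List.getD_and_drop_of_drop_eq_cons hu
    obtain ⟨hj, hy, -⟩ := List.getD_and_drop_of_drop_eq_cons hv
    obtain ⟨p, hhead, hlast, hbd, hchain, hcost⟩ := h
    cases p with
    | nil => simp at hhead
    | cons r p =>
      obtain rfl : r = (i' + 1, j' + 1) := by simpa using hhead
      refine ⟨(i + 1, j + 1) :: (i' + 1, j' + 1) :: p, rfl, by simpa using hlast, ?_,
        List.isChain_cons_cons.mpr ⟨hs, hchain⟩, ?_⟩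
      · intro q hq
        rcases List.mem_cons.mp hq with rfl | hq
        · exact ⟨by simp, hi, by simp, hj⟩
        · exact hbd q hq
      · rw [alignCost_cons, hcost]
        simp only [Nat.add_sub_cancel, hx, hy]
  induction h generalizing i j with
  | single a b =>
    obtain ⟨hi, hx, hx'⟩ := List.getD_and_drop_of_drop_eq_cons hu
    obtain ⟨hj, hy, hy'⟩ := List.getD_and_drop_of_drop_eq_cons hv
    rw [List.drop_eq_nil_iff] at hx' hy'
    have hm : x.length = i + 1 := le_antisymm hx' hi
    have hn : y.length = j + 1 := le_antisymm hy' hj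
    exact ⟨[(i + 1, j + 1)], rfl, by simp [hm, hn], by simp [hm, hn], List.isChain_singleton _,
      by simp only [alignCost, List.map_cons, List.map_nil, List.sum_singleton,
        Nat.add_sub_cancel, hx, hy]⟩
  | left a _ ih =>
    exact extend hu hv (Or.inl ⟨rfl, rfl⟩)
      (ih (i + 1) j (List.getD_and_drop_of_drop_eq_cons hu).2.2 hv)
  | right b _ ih =>
    exact extend (i' := i) (j' := j + 1) hu hv (Or.inr (Or.inl ⟨rfl, rfl⟩))
      (ih i (j + 1) hu (List.getD_and_drop_of_drop_eq_cons hv).2.2)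
  | diag a b _ ih =>
    exact extend hu hv (Or.inr (Or.inr ⟨rfl, rfl⟩))
      (ih (i + 1) (j + 1) (List.getD_and_drop_of_drop_eq_cons hu).2.2
        (List.getD_and_drop_of_drop_eq_cons hv).2.2)

theorem exists_isWarpingPath_iff_alignsWith (x y : List ℚ) (c : ℚ) :
    (∃ p, IsWarpingPath x.length y.length p ∧ alignCost x y p = c) ↔ AlignsWith x y c := by
  constructor
  · rintro ⟨p, hp, rfl⟩
    obtain ⟨hhead, hlast, hbd, hchain⟩ := isWarpingPath_iff.mp hp
    exact alignsWith_drop_of_path x y p 0 0 hhead hlast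
      (fun q hq => ⟨(hbd q hq).2.1, (hbd q hq).2.2.2⟩) hchain
  · intro h
    obtain ⟨p, hhead, hlast, hbd, hchain, hcost⟩ :=
      exists_path_of_alignsWith_drop x y h 0 0 rfl rfl
    exact ⟨p, isWarpingPath_iff.mpr ⟨hhead, hlast, hbd, hchain⟩, hcost⟩

theorem dtwSq_eq_of_isLeast {x y : List ℚ} {c : ℚ} (h : IsLeast {c | AlignsWith x y c} c) :
    dtwSq x y = c := by
  refine IsLeast.csInf_eq ⟨?_, ?_⟩
  · obtain ⟨p, hp, hc⟩ := (exists_isWarpingPath_iff_alignsWith x y c).mpr h.1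
    exact ⟨p, hp, by rw [hc]⟩
  · rintro _ ⟨p, hp, rfl⟩
    exact_mod_cast h.2 ((exists_isWarpingPath_iff_alignsWith x y _).mp ⟨p, hp, rfl⟩)

theorem condense_cons_cons (a b : ℚ) (y : List ℚ) :
    condense (a :: b :: y) = if a = b then condense (b :: y) else a :: condense (b :: y) := by
  simp only [condense, List.destutter_cons', List.destutter'_cons]
  split_ifs <;> simp_all

theorem length_condense_cons_pos (a : ℚ) (y : List ℚ) : 0 < (condense (a :: y)).length :=
  List.length_pos_iff.mpr fun h => by simp [condense] at h

theorem isBinary_cons {a : ℚ} {x : List ℚ} :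
    IsBinary (a :: x) ↔ (a = 0 ∨ a = 1) ∧ IsBinary x :=
  List.forall_mem_cons

theorem isCondensed_cons_cons {a b : ℚ} {x : List ℚ} :
    IsCondensed (a :: b :: x) ↔ a ≠ b ∧ IsCondensed (b :: x) :=
  List.isChain_cons_cons

/-- The mismatch indicator of two symbols. -/
def mismatch (a b : ℚ) : ℕ := if a = b then 0 else 1

theorem sq_sub_eq_mismatch {a b : ℚ} (ha : a = 0 ∨ a = 1) (hb : b = 0 ∨ b = 1) :
    (a - b) ^ 2 = mismatch a b := by
  rcases ha with rfl | rfl <;> rcases hb with rfl | rfl <;> norm_num [mismatch]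

theorem mismatch_self (a : ℚ) : mismatch a a = 0 := if_pos rfl

theorem mismatch_add_mismatch_left {a a' b : ℚ} (ha : a = 0 ∨ a = 1) (ha' : a' = 0 ∨ a' = 1)
    (hb : b = 0 ∨ b = 1) (h : a ≠ a') : mismatch a b + mismatch a' b = 1 := by
  rcases ha with rfl | rfl <;> rcases ha' with rfl | rfl <;> rcases hb with rfl | rfl <;>
    simp_all [mismatch]

theorem mismatch_comm (a b : ℚ) : mismatch a b = mismatch b a := by
  simp only [mismatch, eq_comm]

theorem AlignsWith.exists_cons {x y : List ℚ} {c : ℚ} (h : AlignsWith x y c) :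
    ∃ a u b v, x = a :: u ∧ y = b :: v := by
  cases h <;> exact ⟨_, _, _, _, rfl, rfl⟩

theorem AlignsWith.length_le {x y : List ℚ} {c : ℚ} (h : AlignsWith x y c) {a b : ℚ}
    {u v : List ℚ} (hx : x = a :: u) (hy : y = b :: v)
    (hbx : IsBinary x) (hcx : IsCondensed x) (hby : IsBinary y) :
    ∃ k : ℕ, c = k ∧ x.length + mismatch a b ≤ 2 * k + (condense y).length := by
  induction h generalizing a b u v with
  | single a' b' =>
    obtain ⟨rfl, rfl⟩ := List.cons.inj hx
    obtain ⟨rfl, rfl⟩ := List.cons.inj hy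
    refine ⟨_, sq_sub_eq_mismatch (isBinary_cons.mp hbx).1 (isBinary_cons.mp hby).1, ?_⟩
    simp [condense]
    omega
  | left a' h ih =>
    obtain ⟨rfl, rfl⟩ := List.cons.inj hx
    obtain ⟨rfl, rfl⟩ := List.cons.inj hy
    obtain ⟨a₂, u, _, _, rfl, -⟩ := h.exists_cons
    rw [isBinary_cons] at hbx
    rw [isCondensed_cons_cons] at hcx
    obtain ⟨k, rfl, hk⟩ := ih rfl rfl hbx.2 hcx.2 hby
    have ha₂ := (isBinary_cons.mp hbx.2).1
    rw [isBinary_cons] at hby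
    have := mismatch_add_mismatch_left hbx.1 ha₂ hby.1 hcx.1
    refine ⟨mismatch a' _ + k, by rw [sq_sub_eq_mismatch hbx.1 hby.1]; push_cast; rfl, ?_⟩
    simp only [List.length_cons] at hk ⊢
    omega
  | right b' h ih =>
    obtain ⟨rfl, rfl⟩ := List.cons.inj hx
    obtain ⟨rfl, rfl⟩ := List.cons.inj hy
    obtain ⟨_, _, b₂, v, -, rfl⟩ := h.exists_cons
    rw [isBinary_cons] at hby
    obtain ⟨k, rfl, hk⟩ := ih rfl rfl hbx hcx hby.2
    have hb₂ := (isBinary_cons.mp hby.2).1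
    rw [isBinary_cons] at hbx
    refine ⟨mismatch _ b' + k, by rw [sq_sub_eq_mismatch hbx.1 hby.1]; push_cast; rfl, ?_⟩
    rw [condense_cons_cons]
    split_ifs with hb
    · subst hb
      omega
    · simp only [List.length_cons] at hk ⊢
      omega
  | diag a' b' h ih =>
    obtain ⟨rfl, rfl⟩ := List.cons.inj hx
    obtain ⟨rfl, rfl⟩ := List.cons.inj hy
    obtain ⟨a₂, u, b₂, v, rfl, rfl⟩ := h.exists_cons
    rw [isBinary_cons] at hbx hby
    rw [isCondensed_cons_cons] at hcx
    obtain ⟨k, rfl, hk⟩ := ih rfl rfl hbx.2 hcx.2 hby.2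
    have ha₂ := (isBinary_cons.mp hbx.2).1
    have hb₂ := (isBinary_cons.mp hby.2).1
    have h₁ := mismatch_add_mismatch_left hbx.1 ha₂ hb₂ hcx.1
    refine ⟨mismatch a' b' + k, by rw [sq_sub_eq_mismatch hbx.1 hby.1]; push_cast; rfl, ?_⟩
    rw [condense_cons_cons]
    simp only [List.length_cons] at hk ⊢
    split_ifs with hb
    · subst hb
      omega
    · have h₂ := mismatch_add_mismatch_left hby.1 hb₂ hbx.1 hb
      rw [mismatch_comm b' a', mismatch_comm b₂ a'] at h₂
      simp only [List.length_cons]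
      omega

theorem exists_alignsWith_singleton {a b : ℚ} {u : List ℚ} (hb : b = 0 ∨ b = 1)
    (hbx : IsBinary (a :: u)) (hcx : IsCondensed (a :: u)) :
    ∃ k : ℕ, AlignsWith (a :: u) [b] k ∧ 2 * k ≤ u.length + mismatch a b + 1 := by
  induction u generalizing a with
  | nil =>
    refine ⟨mismatch a b, ?_, ?_⟩
    · rw [← sq_sub_eq_mismatch (isBinary_cons.mp hbx).1 hb]
      exact .single a b
    · unfold mismatch
      split_ifs <;> simp
  | cons a₂ u ih =>
    rw [isBinary_cons] at hbx
    rw [isCondensed_cons_cons] at hcx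
    obtain ⟨k, hk, hle⟩ := ih hbx.2 hcx.2
    have := mismatch_add_mismatch_left hbx.1 (isBinary_cons.mp hbx.2).1 hb hcx.1
    refine ⟨mismatch a b + k, ?_, ?_⟩
    · rw [Nat.cast_add, ← sq_sub_eq_mismatch hbx.1 hb]
      exact hk.left a
    · simp only [List.length_cons]
      omega

theorem exists_alignsWith_of_head_eq {b : ℚ} {u v : List ℚ}
    (hbx : IsBinary (b :: u)) (hcx : IsCondensed (b :: u)) (hby : IsBinary (b :: v))
    (hle : (condense (b :: v)).length ≤ (b :: u).length) :
    ∃ k : ℕ, AlignsWith (b :: u) (b :: v) k ∧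
      2 * k + (condense (b :: v)).length ≤ (b :: u).length + 1 := by
  induction v generalizing b u with
  | nil =>
    obtain ⟨k, hk, h⟩ := exists_alignsWith_singleton (isBinary_cons.mp hby).1 hbx hcx
    rw [mismatch_self] at h
    refine ⟨k, hk, ?_⟩
    simp [condense]
    omega
  | cons b₂ v ih =>
    rw [isBinary_cons] at hby
    rw [condense_cons_cons] at hle ⊢
    split_ifs at hle ⊢ with hb
    · subst hb
      obtain ⟨k, hk, h⟩ := ih hbx hcx hby.2 hle
      exact ⟨k, by simpa using hk.right b, h⟩
    · have hpos := length_condense_cons_pos b₂ v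
      simp only [List.length_cons] at hle ⊢
      cases u with
      | nil => simp only [List.length_nil] at hle; omega
      | cons a₂ u =>
        rw [isBinary_cons] at hbx
        rw [isCondensed_cons_cons] at hcx
        obtain rfl : a₂ = b₂ := by
          have h₁ := (isBinary_cons.mp hbx.2).1
          have h₂ := (isBinary_cons.mp hby.2).1
          have h₃ := hcx.1
          grind
        obtain ⟨k, hk, h⟩ := ih hbx.2 hcx.2 hby.2 (by simpa using hle)
        refine ⟨k, by simpa using hk.diag b b, ?_⟩
        simp only [List.length_cons] at h ⊢
        omega

theorem exists_alignsWith_of_length_condense_lt {a b : ℚ} {u v : List ℚ}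
    (hbx : IsBinary (a :: u)) (hcx : IsCondensed (a :: u)) (hby : IsBinary (b :: v))
    (hlt : (condense (b :: v)).length < (a :: u).length) :
    ∃ k : ℕ, AlignsWith (a :: u) (b :: v) k ∧
      2 * k + (condense (b :: v)).length ≤ (a :: u).length + mismatch a b + 1 := by
  by_cases hab : a = b
  · subst hab
    rw [mismatch_self]
    exact exists_alignsWith_of_head_eq hbx hcx hby hlt.le
  · have hpos := length_condense_cons_pos b v
    cases u with
    | nil => simp only [List.length_cons, List.length_nil] at hlt; omega
    | cons a₂ u =>
      rw [isBinary_cons] at hbx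
      rw [isCondensed_cons_cons] at hcx
      have hb := (isBinary_cons.mp hby).1
      obtain rfl : a₂ = b := by
        have h₁ := (isBinary_cons.mp hbx.2).1
        have h₂ := hcx.1
        grind
      obtain ⟨k, hk, h⟩ := exists_alignsWith_of_head_eq hbx.2 hcx.2 hby
        (by simp only [List.length_cons] at hlt ⊢; omega)
      have hm : mismatch a a₂ = 1 := if_neg hab
      refine ⟨mismatch a a₂ + k, ?_, ?_⟩
      · rw [Nat.cast_add, ← sq_sub_eq_mismatch hbx.1 hb]
        exact hk.left a
      · simp only [List.length_cons] at h ⊢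
        omega

/-- The closed form of the squared dtw-distance to a series with fewer blocks. -/
theorem dtwSq_eq_of_length_condense_lt {a b : ℚ} {u v : List ℚ}
    (hbx : IsBinary (a :: u)) (hcx : IsCondensed (a :: u)) (hby : IsBinary (b :: v))
    (hlt : (condense (b :: v)).length < (a :: u).length) :
    dtwSq (a :: u) (b :: v) =
      (((a :: u).length + mismatch a b + 1 - (condense (b :: v)).length) / 2 : ℕ) := by
  obtain ⟨k, hk, hle⟩ := exists_alignsWith_of_length_condense_lt hbx hcx hby hlt
  have hk_le : ∀ c, AlignsWith (a :: u) (b :: v) c → (k : ℚ) ≤ c := by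
    intro c hc
    obtain ⟨l, rfl, hl⟩ := hc.length_le rfl rfl hbx hcx hby
    exact_mod_cast (by omega : k ≤ l)
  obtain ⟨l, hl_eq, hl⟩ := hk.length_le rfl rfl hbx hcx hby
  obtain rfl : k = l := by exact_mod_cast hl_eq
  rw [dtwSq_eq_of_isLeast ⟨hk, hk_le⟩, Rat.cast_natCast]
  congr 1
  omega

theorem condense_cons_eq_cons (b : ℚ) (v : List ℚ) : ∃ w, condense (b :: v) = b :: w := by
  induction v with
  | nil => exact ⟨[], rfl⟩
  | cons b₂ v ih =>
    rw [condense_cons_cons]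
    split_ifs with h
    · subst h
      induction v <;> simp_all
    · exact ⟨_, rfl⟩

theorem condense_condense (y : List ℚ) : condense (condense y) = condense y :=
  List.destutter_idem _ _

/-- For a condensed binary time series `x` and any binary time series `y` with
`x.length ≥ y.length`, the squared dtw-distance to `y` equals the squared
dtw-distance to the condensation of `y`. -/
theorem dtwSq_condense_right_eq (x y : List ℚ)
    (hbx : IsBinary x) (hcx : IsCondensed x) (hby : IsBinary y)
    (hnm : y.length ≤ x.length) :
    dtwSq x y = dtwSq x (condense y) := by
  have hsub : (condense y).Sublist y := List.destutter_sublist _ _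
  rcases hsub.length_le.eq_or_lt with heq | hlt
  · rw [hsub.eq_of_length heq]
  · have hltx := hlt.trans_le hnm
    obtain ⟨a, u, rfl⟩ := List.exists_cons_of_length_pos (Nat.zero_lt_of_lt hltx)
    obtain ⟨b, v, rfl⟩ := List.exists_cons_of_length_pos (Nat.zero_lt_of_lt hlt)
    rw [dtwSq_eq_of_length_condense_lt hbx hcx hby hltx]
    have hidem := condense_condense (b :: v)
    have hbc : IsBinary (condense (b :: v)) := fun c hc => hby c (hsub.subset hc)
    obtain ⟨w, hw⟩ := condense_cons_eq_cons b v
    rw [hw] at hidem hbc hltx ⊢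
    rw [dtwSq_eq_of_length_condense_lt hbx hcx hbc (by rwa [hidem]), hidem]
end

section
/- Let x^(1), …, x^(k) be binary time series of maximum length n and let w_1, …, w_k be nonnegative rational weights. Then there exists a condensed binary time series z of length at most n + 1 such that F_w(z) ≤ F_w(z') for every binary time series z'. In particular, a minimizer of F_w over all binary time series can be found among the at most 2n + 2 condensed binary time series of length at most n + 1. -/
/-- The weighted Fréchet function of the sample `x` with weights `w`. -/
noncomputable def frechet (k : ℕ) (x : Fin k → List ℚ) (w : Fin k → ℚ)
    (z : List ℚ) : ℝ :=
  ∑ j : Fin k, (w j : ℝ) * dtwSq z (x j)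

/-- `Warps x y c` says that some warping path aligns `x` and `y` at cost `c`; the path is
described recursively by its first step. -/
inductive Warps : List ℚ → List ℚ → ℚ → Prop
  | single (a b : ℚ) : Warps [a] [b] ((a - b) ^ 2)
  | left {a b c : ℚ} {x y : List ℚ} (h : Warps x (b :: y) c) :
      Warps (a :: x) (b :: y) ((a - b) ^ 2 + c)
  | right {a b c : ℚ} {x y : List ℚ} (h : Warps (a :: x) y c) :
      Warps (a :: x) (b :: y) ((a - b) ^ 2 + c)
  | both {a b c : ℚ} {x y : List ℚ} (h : Warps x y c) :
      Warps (a :: x) (b :: y) ((a - b) ^ 2 + c)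

namespace Warps

theorem left_ne_nil {x y : List ℚ} {c : ℚ} (h : Warps x y c) : x ≠ [] := by
  cases h <;> simp

theorem right_ne_nil {x y : List ℚ} {c : ℚ} (h : Warps x y c) : y ≠ [] := by
  cases h <;> simp

theorem cost_nonneg {x y : List ℚ} {c : ℚ} (h : Warps x y c) : 0 ≤ c := by
  induction h <;> positivity

theorem exists_of_ne_nil {x y : List ℚ} (hx : x ≠ []) (hy : y ≠ []) : ∃ c, Warps x y c := by
  obtain ⟨b, y, rfl⟩ := List.exists_cons_of_ne_nil hy
  clear hy
  induction x with
  | nil => exact absurd rfl hx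
  | cons a x ih =>
    by_cases h : x = []
    · subst h
      clear ih hx
      induction y generalizing b with
      | nil => exact ⟨_, single a b⟩
      | cons b' y ih =>
        obtain ⟨c, hc⟩ := ih b'
        exact ⟨_, right hc⟩
    · obtain ⟨c, hc⟩ := ih h
      exact ⟨_, left hc⟩

/-- Replacing the tail of the left series by one that is never more expensive to align keeps
this property for the whole series. -/
theorem cons_mono {t t' : List ℚ} (ht : t ≠ [])
    (hmono : ∀ y c, Warps t y c → ∃ c' ≤ c, Warps t' y c') (a : ℚ) {y : List ℚ} {c : ℚ}
    (h : Warps (a :: t) y c) : ∃ c' ≤ c, Warps (a :: t') y c' := by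
  induction y generalizing c with
  | nil => exact absurd rfl h.right_ne_nil
  | cons b y ih =>
    cases h with
    | single => exact absurd rfl ht
    | left h =>
      obtain ⟨c', hc, h'⟩ := hmono _ _ h
      exact ⟨_, by gcongr, left h'⟩
    | right h =>
      obtain ⟨c', hc, h'⟩ := ih h
      exact ⟨_, by gcongr, right h'⟩
    | both h =>
      obtain ⟨c', hc, h'⟩ := hmono _ _ h
      exact ⟨_, by gcongr, both h'⟩

/-- Merging two equal leading elements does not increase the alignment cost. -/
theorem merge {a : ℚ} {s y : List ℚ} {c : ℚ} (h : Warps (a :: a :: s) y c) :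
    ∃ c' ≤ c, Warps (a :: s) y c' := by
  induction y generalizing c with
  | nil => exact absurd rfl h.right_ne_nil
  | cons b y ih =>
    cases h with
    | left h => exact ⟨_, le_add_of_nonneg_left (sq_nonneg _), h⟩
    | right h =>
      obtain ⟨c', hc, h'⟩ := ih h
      exact ⟨_, by gcongr, right h'⟩
    | both h => exact ⟨_, le_rfl, right h⟩

end Warps

/-- The alternating series `a, 1 - a, a, …` of length `m`. -/
def alternating (a : ℚ) : ℕ → List ℚ
  | 0 => []
  | m + 1 => a :: alternating (1 - a) m

theorem alternating_length (a : ℚ) (m : ℕ) : (alternating a m).length = m := by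
  induction m generalizing a with
  | zero => rfl
  | succ m ih => simp [alternating, ih]

theorem alternating_ne_nil (a : ℚ) {m : ℕ} (hm : m ≠ 0) : alternating a m ≠ [] := by
  rw [← List.length_pos_iff, alternating_length]
  omega

theorem isBinary_alternating {a : ℚ} (ha : a = 0 ∨ a = 1) (m : ℕ) :
    IsBinary (alternating a m) := by
  induction m generalizing a with
  | zero => simp [IsBinary, alternating]
  | succ m ih =>
    have h1 : 1 - a = 0 ∨ 1 - a = 1 := by rcases ha with rfl | rfl <;> simp
    intro b hb
    rcases List.mem_cons.1 hb with rfl | hb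
    · exact ha
    · exact ih h1 b hb

theorem isCondensed_alternating {a : ℚ} (ha : a = 0 ∨ a = 1) (m : ℕ) :
    IsCondensed (alternating a m) := by
  have key : ∀ (m : ℕ) (a : ℚ), (a = 0 ∨ a = 1) →
      List.IsChain (· ≠ ·) (alternating a m) := by
    intro m
    induction m with
    | zero => intro a _; simp [alternating]
    | succ m ih =>
      intro a ha
      have h1 := ih (1 - a) (by rcases ha with rfl | rfl <;> simp)
      cases m with
      | zero => simp [alternating]
      | succ m =>
        refine List.IsChain.cons_cons ?_ h1
        rcases ha with rfl | rfl <;> norm_num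
  exact key m a ha

/-- An alternating series can be shortened by two without increasing the cost of aligning it
with a series which is no longer than the result. -/
theorem Warps.alternating_shorten {a : ℚ} (ha : a = 0 ∨ a = 1) {y : List ℚ} {m : ℕ}
    (hy : y.length ≤ m) {c : ℚ} (h : Warps (alternating a (m + 2)) y c) :
    ∃ c' ≤ c, Warps (alternating a m) y c' := by
  induction y generalizing a m c with
  | nil => exact absurd rfl h.right_ne_nil
  | cons u y ih =>
    obtain _ | m := m
    · simp at hy
    have hy' : y.length ≤ m := by simpa using hy
    have h1 : 1 - a = 0 ∨ 1 - a = 1 := by rcases ha with rfl | rfl <;> simp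
    change Warps (a :: alternating (1 - a) (m + 2)) _ _ at h
    cases h with
    | right h =>
      obtain ⟨c', hc, h'⟩ := ih ha (by omega) h
      exact ⟨_, by gcongr, right h'⟩
    | both h =>
      obtain ⟨c', hc, h'⟩ := ih h1 hy' h
      exact ⟨_, by gcongr, both h'⟩
    | left h =>
      generalize hA : alternating (1 - a) (m + 2) = A at h
      have hA' : A = (1 - a) :: alternating a (m + 1) := by
        rw [← hA]; simp [alternating]
      subst hA'
      cases h with
      | left h =>
        exact ⟨_, by nlinarith [sq_nonneg (a - u), sq_nonneg (1 - a - u)], h⟩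
      | both h =>
        refine ⟨_, ?_, right h⟩
        nlinarith [sq_nonneg (1 - a - u)]
      | right h =>
        rw [← hA] at h
        obtain ⟨c', hc, h'⟩ := ih h1 hy' h
        refine ⟨_, ?_, both h'⟩
        nlinarith [sq_nonneg (1 - a - u)]

/-- Every nonempty binary series has an alternating series which is never more expensive to
align with any other series. -/
theorem exists_alternating_warps_le {z : List ℚ} (hz : IsBinary z) (hne : z ≠ []) :
    ∃ a m, (a = 0 ∨ a = 1) ∧ m ≠ 0 ∧
      ∀ y c, Warps z y c → ∃ c' ≤ c, Warps (alternating a m) y c' := by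
  induction z with
  | nil => exact absurd rfl hne
  | cons a t ih =>
    have ha : a = 0 ∨ a = 1 := hz a (by simp)
    by_cases ht : t = []
    · subst ht
      exact ⟨a, 1, ha, one_ne_zero, fun y c h => ⟨c, le_rfl, h⟩⟩
    · obtain ⟨b, m, hb, hm, hmono⟩ := ih (fun q hq => hz q (by simp [hq])) ht
      by_cases hab : a = b
      · subst hab
        refine ⟨a, m, ha, hm, fun y c h => ?_⟩
        obtain ⟨c₁, hc₁, h₁⟩ := Warps.cons_mono ht hmono a h
        obtain _ | m := m
        · exact absurd rfl hm
        obtain ⟨c₂, hc₂, h₂⟩ := h₁.merge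
        exact ⟨c₂, hc₂.trans hc₁, h₂⟩
      · have hb' : b = 1 - a := by
          rcases ha with rfl | rfl <;> rcases hb with rfl | rfl <;> simp_all
        subst hb'
        exact ⟨a, m + 1, ha, by omega, fun y c h => Warps.cons_mono ht hmono a h⟩

/-- An admissible step of a warping path. -/
def IsWarpingStep (q r : ℕ × ℕ) : Prop :=
  (r.1 = q.1 + 1 ∧ r.2 = q.2) ∨ (r.1 = q.1 ∧ r.2 = q.2 + 1) ∨ (r.1 = q.1 + 1 ∧ r.2 = q.2 + 1)

/-- A warping path that may start at any position `q`. -/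
def IsWarpingPathFrom (q : ℕ × ℕ) (m n : ℕ) (p : List (ℕ × ℕ)) : Prop :=
  p.head? = some q ∧ p.getLast? = some (m, n) ∧
  (∀ r ∈ p, 1 ≤ r.1 ∧ r.1 ≤ m ∧ 1 ≤ r.2 ∧ r.2 ≤ n) ∧
  ∀ ℓ : ℕ, ℓ + 1 < p.length → IsWarpingStep (p.getD ℓ (0, 0)) (p.getD (ℓ + 1) (0, 0))

theorem isWarpingPathFrom_singleton {q : ℕ × ℕ} {m n : ℕ} :
    IsWarpingPathFrom q m n [q] ↔ q = (m, n) ∧ 1 ≤ m ∧ 1 ≤ n := by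
  obtain ⟨i, j⟩ := q
  constructor
  · rintro ⟨-, h2, h3, -⟩
    simp at h2 h3
    obtain ⟨rfl, rfl⟩ := h2
    exact ⟨rfl, by omega, by omega⟩
  · rintro ⟨h, h1, h2⟩
    rw [h]
    exact ⟨rfl, rfl, by simp [h1, h2], by simp⟩

theorem isWarpingPathFrom_cons_cons {q r : ℕ × ℕ} {m n : ℕ} {p : List (ℕ × ℕ)} :
    IsWarpingPathFrom q m n (q :: r :: p) ↔
      (1 ≤ q.1 ∧ q.1 ≤ m ∧ 1 ≤ q.2 ∧ q.2 ≤ n) ∧ IsWarpingStep q r ∧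
        IsWarpingPathFrom r m n (r :: p) := by
  constructor
  · rintro ⟨-, h2, h3, h4⟩
    refine ⟨h3 q (by simp), by simpa using h4 0 (by simp), rfl, by simpa using h2,
      fun s hs => h3 s (List.mem_cons_of_mem _ hs), fun ℓ hℓ => ?_⟩
    simpa using h4 (ℓ + 1) (by simpa using hℓ)
  · rintro ⟨h1, h2, -, h3, h4, h5⟩
    refine ⟨rfl, by simpa using h3, fun s hs => ?_, fun ℓ hℓ => ?_⟩
    · rcases List.mem_cons.1 hs with rfl | hs
      · exact h1
      · exact h4 s hs
    · cases ℓ with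
      | zero => simpa using h2
      | succ ℓ => simpa using h5 ℓ (by simpa using hℓ)

theorem drop_eq_getD_cons {x : List ℚ} {i : ℕ} (hi : i < x.length) :
    x.drop i = x.getD i 0 :: x.drop (i + 1) := by
  rw [List.drop_eq_getElem_cons hi, List.getD_eq_getElem _ _ hi]

theorem IsWarpingPathFrom.warps {x y : List ℚ} {p : List (ℕ × ℕ)} {i j : ℕ}
    (h : IsWarpingPathFrom (i + 1, j + 1) x.length y.length p) :
    Warps (x.drop i) (y.drop j) (alignCost x y p) := by
  induction p generalizing i j with
  | nil => simp [IsWarpingPathFrom] at h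
  | cons q p ih =>
    obtain rfl : q = (i + 1, j + 1) := by simpa using h.1
    cases p with
    | nil =>
      obtain ⟨h, -, -⟩ := isWarpingPathFrom_singleton.1 h
      obtain ⟨hi, hj⟩ := Prod.mk.inj h
      rw [drop_eq_getD_cons (x := x) (i := i) (by omega),
        drop_eq_getD_cons (x := y) (i := j) (by omega), hi, hj, List.drop_length, List.drop_length,
        ← hi, ← hj]
      simpa [alignCost] using Warps.single _ _
    | cons r p =>
      obtain ⟨⟨-, hi, -, hj⟩, hs, hp⟩ := isWarpingPathFrom_cons_cons.1 h
      obtain ⟨i', j'⟩ := r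
      have hx := drop_eq_getD_cons (x := x) (i := i) hi
      have hy := drop_eq_getD_cons (x := y) (i := j) hj
      rw [alignCost_cons]
      rcases hs with ⟨h1, h2⟩ | ⟨h1, h2⟩ | ⟨h1, h2⟩ <;> simp only at h1 h2 <;>
        subst h1 <;> subst h2 <;> have hw := ih hp
      · rw [hy] at hw ⊢
        rw [hx]
        exact hw.left
      · rw [hx] at hw ⊢
        rw [hy]
        exact hw.right
      · rw [hx, hy]
        exact hw.both

theorem IsWarpingPathFrom.exists_cons {x y : List ℚ} {i j : ℕ} {r : ℕ × ℕ} {c : ℚ}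
    (hi : i < x.length) (hj : j < y.length) (hs : IsWarpingStep (i + 1, j + 1) r)
    (h : ∃ p, IsWarpingPathFrom r x.length y.length p ∧ alignCost x y p = c) :
    ∃ p, IsWarpingPathFrom (i + 1, j + 1) x.length y.length p ∧
      alignCost x y p = (x.getD i 0 - y.getD j 0) ^ 2 + c := by
  obtain ⟨p, hp, rfl⟩ := h
  obtain _ | ⟨s, p⟩ := p
  · simp [IsWarpingPathFrom] at hp
  · obtain rfl : s = r := by simpa using hp.1
    refine ⟨(i + 1, j + 1) :: s :: p, isWarpingPathFrom_cons_cons.2 ⟨?_, hs, hp⟩, ?_⟩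
    · simp only
      omega
    · rw [alignCost_cons]
      simp

theorem Warps.exists_isWarpingPathFrom {x y s t : List ℚ} {i j : ℕ} {c : ℚ}
    (h : Warps s t c) (hs : x.drop i = s) (ht : y.drop j = t) :
    ∃ p, IsWarpingPathFrom (i + 1, j + 1) x.length y.length p ∧ alignCost x y p = c := by
  have hi : i < x.length := by
    by_contra! hi
    exact h.left_ne_nil (by rw [← hs, List.drop_eq_nil_of_le hi])
  have hj : j < y.length := by
    by_contra! hj
    exact h.right_ne_nil (by rw [← ht, List.drop_eq_nil_of_le hj])
  induction h generalizing i j with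
  | single a b =>
    have hx := hs
    have hy := ht
    rw [drop_eq_getD_cons hi, List.cons.injEq, List.drop_eq_nil_iff] at hx
    rw [drop_eq_getD_cons hj, List.cons.injEq, List.drop_eq_nil_iff] at hy
    refine ⟨[(i + 1, j + 1)], isWarpingPathFrom_singleton.2 ⟨?_, by omega, by omega⟩, ?_⟩
    · rw [Prod.mk.injEq]
      omega
    · simp only [alignCost, List.map_cons, List.map_nil, List.sum_singleton,
        Nat.add_sub_cancel, hx.1, hy.1]
  | left h ih =>
    have hx := hs
    have hy := ht
    rw [drop_eq_getD_cons hi, List.cons.injEq] at hx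
    rw [drop_eq_getD_cons hj, List.cons.injEq] at hy
    rw [← hx.1, ← hy.1]
    refine IsWarpingPathFrom.exists_cons (r := (i + 1 + 1, j + 1)) hi hj (Or.inl ⟨rfl, rfl⟩)
      (ih hx.2 ht ?_ hj)
    by_contra! hi
    exact h.left_ne_nil (by rw [← hx.2, List.drop_eq_nil_of_le hi])
  | right h ih =>
    have hx := hs
    have hy := ht
    rw [drop_eq_getD_cons hi, List.cons.injEq] at hx
    rw [drop_eq_getD_cons hj, List.cons.injEq] at hy
    rw [← hx.1, ← hy.1]
    refine IsWarpingPathFrom.exists_cons (r := (i + 1, j + 1 + 1)) hi hj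
      (Or.inr (Or.inl ⟨rfl, rfl⟩)) (ih hs hy.2 hi ?_)
    by_contra! hj
    exact h.right_ne_nil (by rw [← hy.2, List.drop_eq_nil_of_le hj])
  | both h ih =>
    have hx := hs
    have hy := ht
    rw [drop_eq_getD_cons hi, List.cons.injEq] at hx
    rw [drop_eq_getD_cons hj, List.cons.injEq] at hy
    rw [← hx.1, ← hy.1]
    refine IsWarpingPathFrom.exists_cons hi hj (Or.inr (Or.inr ⟨rfl, rfl⟩)) (ih hx.2 hy.2 ?_ ?_)
    · by_contra! hi
      exact h.left_ne_nil (by rw [← hx.2, List.drop_eq_nil_of_le hi])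
    · by_contra! hj
      exact h.right_ne_nil (by rw [← hy.2, List.drop_eq_nil_of_le hj])

theorem warps_iff {x y : List ℚ} {c : ℚ} :
    Warps x y c ↔ ∃ p, IsWarpingPath x.length y.length p ∧ alignCost x y p = c := by
  constructor
  · intro h
    exact h.exists_isWarpingPathFrom (i := 0) (j := 0) rfl rfl
  · rintro ⟨p, hp, rfl⟩
    exact IsWarpingPathFrom.warps (i := 0) (j := 0) hp

theorem dtwSq_eq_sInf_warps (x y : List ℚ) :
    dtwSq x y = sInf ((fun c : ℚ => (c : ℝ)) '' {c | Warps x y c}) := by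
  unfold dtwSq
  congr 1
  ext r
  constructor
  · rintro ⟨p, hp, rfl⟩
    exact ⟨_, warps_iff.2 ⟨p, hp, rfl⟩, rfl⟩
  · rintro ⟨c, hc, rfl⟩
    obtain ⟨p, hp, rfl⟩ := warps_iff.1 hc
    exact ⟨p, hp, rfl⟩

theorem dtwSq_le_dtwSq {z z' y : List ℚ} (hz' : z' ≠ [])
    (h : ∀ c, Warps z' y c → ∃ c' ≤ c, Warps z y c') : dtwSq z y ≤ dtwSq z' y := by
  rw [dtwSq_eq_sInf_warps, dtwSq_eq_sInf_warps]
  by_cases hy : y = []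
  · have hempty : ∀ s : List ℚ, {c | Warps s y c} = ∅ := fun s =>
      Set.eq_empty_of_forall_notMem fun c hc => Warps.right_ne_nil hc hy
    rw [hempty, hempty]
  · obtain ⟨c₀, hc₀⟩ := Warps.exists_of_ne_nil hz' hy
    refine le_csInf ⟨_, c₀, hc₀, rfl⟩ ?_
    rintro _ ⟨c, hc, rfl⟩
    obtain ⟨c', hle, hc'⟩ := h c hc
    have hbdd : BddBelow ((fun c : ℚ => (c : ℝ)) '' {c | Warps z y c}) := by
      refine ⟨0, ?_⟩
      rintro _ ⟨d, hd, rfl⟩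
      exact Rat.cast_nonneg.2 (Warps.cost_nonneg hd)
    exact (csInf_le hbdd ⟨c', hc', rfl⟩).trans (Rat.cast_le.2 hle)

theorem frechet_le_frechet {k : ℕ} {x : Fin k → List ℚ} {w : Fin k → ℚ} (hw : ∀ j, 0 ≤ w j)
    {z z' : List ℚ} (hz' : z' ≠ [])
    (h : ∀ j c, Warps z' (x j) c → ∃ c' ≤ c, Warps z (x j) c') :
    frechet k x w z ≤ frechet k x w z' :=
  Finset.sum_le_sum fun j _ =>
    mul_le_mul_of_nonneg_left (dtwSq_le_dtwSq hz' (h j)) (by exact_mod_cast hw j)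

theorem exists_short_frechet_alternating_le {k n : ℕ} {x : Fin k → List ℚ}
    (hlen : ∀ j, (x j).length ≤ n) {w : Fin k → ℚ} (hw : ∀ j, 0 ≤ w j) {a : ℚ}
    (ha : a = 0 ∨ a = 1) {m : ℕ} (hm : m ≠ 0) :
    ∃ m', m' ≠ 0 ∧ m' ≤ n + 1 ∧
      frechet k x w (alternating a m') ≤ frechet k x w (alternating a m) := by
  induction m using Nat.strong_induction_on with
  | _ m ih =>
    by_cases hmn : m ≤ n + 1
    · exact ⟨m, hm, hmn, le_rfl⟩
    obtain ⟨l, rfl⟩ : ∃ l, m = l + 2 := ⟨m - 2, by omega⟩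
    have hle : frechet k x w (alternating a l) ≤ frechet k x w (alternating a (l + 2)) :=
      frechet_le_frechet hw (alternating_ne_nil a hm) fun j c h =>
        h.alternating_shorten ha ((hlen j).trans (by omega))
    by_cases hl : l = 0
    · subst hl
      obtain rfl : n = 0 := by omega
      refine ⟨1, one_ne_zero, le_rfl, frechet_le_frechet hw (alternating_ne_nil a hm) ?_⟩
      intro j c h
      exact absurd (List.length_eq_zero_iff.1 (Nat.le_zero.1 (hlen j))) h.right_ne_nil
    · obtain ⟨m', h1, h2, h3⟩ := ih l (by omega) hl
      exact ⟨m', h1, h2, h3.trans hle⟩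

/-- For binary sample time series of maximum length `n` and nonnegative
rational weights, there is a condensed binary time series of length at most
`n + 1` minimizing the weighted Fréchet function over all binary time
series. -/
theorem binary_mean_condensed_short (k n : ℕ) (x : Fin k → List ℚ)
    (hbx : ∀ j, IsBinary (x j)) (hlen : ∀ j, (x j).length ≤ n)
    (w : Fin k → ℚ) (hw : ∀ j, 0 ≤ w j) :
    ∃ z : List ℚ, IsBinary z ∧ IsCondensed z ∧ z ≠ [] ∧ z.length ≤ n + 1 ∧
      ∀ z' : List ℚ, IsBinary z' → z' ≠ [] →
        frechet k x w z ≤ frechet k x w z' := by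
  obtain ⟨⟨a, m⟩, hmem, hmin⟩ := Finset.exists_min_image
    (({0, 1} : Finset ℚ) ×ˢ Finset.Icc 1 (n + 1)) (fun q => frechet k x w (alternating q.1 q.2))
    ⟨(0, 1), by simp⟩
  simp only [Finset.mem_product, Finset.mem_insert, Finset.mem_singleton, Finset.mem_Icc,
    Prod.forall] at hmem hmin
  obtain ⟨ha, hm1, hm⟩ := hmem
  refine ⟨alternating a m, isBinary_alternating ha m, isCondensed_alternating ha m,
    alternating_ne_nil a (by omega), by rwa [alternating_length], fun z' hbz hz' => ?_⟩
  obtain ⟨b, l, hb, hl, hmono⟩ := exists_alternating_warps_le hbz hz'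
  obtain ⟨l', hl0, hl', hle⟩ := exists_short_frechet_alternating_le hlen hw hb hl
  exact (hmin b l' ⟨hb, by omega, hl'⟩).trans
    (hle.trans (frechet_le_frechet hw hz' fun j => hmono (x j)))
end
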